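/- arXiv:2106.02558 — 2 statements merged into one kernel-verified Lean document; each statement's English description precedes it below -/
import Mathlib

section
/- Let T be the risk-neutral Bellman operator of the Bayesian risk MDP. If V and V' are both in the admissible class B and both satisfy the risk-adjusted Bellman equation, i.e. (T V)(s,μ) = V(s,μ) and (T V')(s,μ) = V'(s,μ) for all s ∈ S and all probability measures μ on Θ, then V = V'. That is, the risk-adjusted Bellman equation has at most one solution within the class of bounded admissible functions. -/
open MeasureTheory

/-- Bayesian posterior update: given likelihood densities `f θ ξ` (w.r.t. a reference
measure on `Ξ`), a prior `μ` on `Θ` and an observation `ξ`, the posterior is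
`(f(·,ξ)/Z_μ(ξ)) dμ` where `Z_μ(ξ) = ∫ f(θ,ξ) dμ(θ)`, with the convention that the
posterior is `μ` itself when `Z_μ(ξ) = 0`. -/
noncomputable def posterior {Θ Ξ : Type*} [MeasurableSpace Θ]
    (f : Θ → Ξ → ℝ) (μ : Measure Θ) (ξ : Ξ) : Measure Θ :=
  if (∫ θ, f θ ξ ∂μ) = 0 then μ
  else μ.withDensity (fun θ => ENNReal.ofReal (f θ ξ / ∫ θ', f θ' ξ ∂μ))

/-- The risk-neutral Bellman operator of the Bayesian risk MDP:
`(T V)(s,μ) = min_{a ∈ A} ∫_Θ ∫_Ξ [C(s,a,ξ) + γ V(g(s,a,ξ), U(μ,ξ))] f(θ,ξ) dν(ξ) dμ(θ)`. -/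
noncomputable def bellman {Θ Ξ S A : Type*} [MeasurableSpace Θ] [MeasurableSpace Ξ]
    [Fintype A] [Nonempty A]
    (ν : Measure Ξ) (f : Θ → Ξ → ℝ) (g : S → A → Ξ → S) (C : S → A → Ξ → ℝ) (γ : ℝ)
    (V : S → Measure Θ → ℝ) : S → Measure Θ → ℝ :=
  fun s μ => Finset.univ.inf' Finset.univ_nonempty
    (fun a : A => ∫ θ, (∫ ξ, (C s a ξ + γ * V (g s a ξ) (posterior f μ ξ)) * f θ ξ ∂ν) ∂μ)

/-- The admissible class `B`: bounded functions `V : S × P(Θ) → ℝ` such that for every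
state, action and probability measure `μ` the integrand of the Bellman operator is
integrable with respect to `μ ⊗ ν`. -/
def Admissible {Θ Ξ S A : Type*} [MeasurableSpace Θ] [MeasurableSpace Ξ]
    (ν : Measure Ξ) (f : Θ → Ξ → ℝ) (g : S → A → Ξ → S) (C : S → A → Ξ → ℝ) (γ : ℝ)
    (V : S → Measure Θ → ℝ) : Prop :=
  (∃ M : ℝ, ∀ (s : S) (μ : Measure Θ), |V s μ| ≤ M) ∧
  ∀ (s : S) (a : A) (μ : Measure Θ), IsProbabilityMeasure μ →
    Integrable
      (fun p : Θ × Ξ => (C s a p.2 + γ * V (g s a p.2) (posterior f μ p.2)) * f p.1 p.2)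
      (μ.prod ν)

/-- The posterior of a probability measure is a probability measure. -/
theorem isProbabilityMeasure_posterior {Θ Ξ : Type*} [MeasurableSpace Θ]
    {f : Θ → Ξ → ℝ} (hf_nonneg : ∀ θ ξ, 0 ≤ f θ ξ)
    (μ : Measure Θ) [IsProbabilityMeasure μ] (ξ : Ξ) :
    IsProbabilityMeasure (posterior f μ ξ) := by
  unfold posterior
  split_ifs with h
  · infer_instance
  · have hint : Integrable (fun θ => f θ ξ) μ := Integrable.of_integral_ne_zero h
    have hnn : 0 ≤ ∫ θ, f θ ξ ∂μ := integral_nonneg fun θ => hf_nonneg θ ξ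
    refine ⟨?_⟩
    rw [withDensity_apply _ MeasurableSet.univ, Measure.restrict_univ,
      ← ofReal_integral_eq_lintegral_ofReal (hint.div_const _)
        (Filter.Eventually.of_forall fun θ => div_nonneg (hf_nonneg θ ξ) hnn),
      integral_div, div_self h, ENNReal.ofReal_one]

/-- A family of probability densities is jointly integrable against a probability measure. -/
theorem integrable_density_prod {Θ Ξ : Type*} [MeasurableSpace Θ] [MeasurableSpace Ξ]
    {ν : Measure Ξ} [SigmaFinite ν] {f : Θ → Ξ → ℝ}
    (hf_meas : Measurable (Function.uncurry f)) (hf_nonneg : ∀ θ ξ, 0 ≤ f θ ξ)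
    (hf_int : ∀ θ, ∫ ξ, f θ ξ ∂ν = 1) (μ : Measure Θ) [IsProbabilityMeasure μ] :
    Integrable (fun p : Θ × Ξ => f p.1 p.2) (μ.prod ν) := by
  refine (integrable_prod_iff (f := fun p : Θ × Ξ => f p.1 p.2)
    hf_meas.aestronglyMeasurable).2 ⟨Filter.Eventually.of_forall fun θ => ?_, ?_⟩
  · exact Integrable.of_integral_ne_zero (by simp [hf_int])
  · simp [Real.norm_of_nonneg (hf_nonneg _ _), hf_int]

/-- One-sided contraction estimate for the Bellman operator. -/
theorem bellman_le_bellman_add {Θ Ξ S A : Type*} [MeasurableSpace Θ] [MeasurableSpace Ξ]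
    [Fintype A] [Nonempty A] {ν : Measure Ξ} [SigmaFinite ν] {f : Θ → Ξ → ℝ}
    (hf_meas : Measurable (Function.uncurry f)) (hf_nonneg : ∀ θ ξ, 0 ≤ f θ ξ)
    (hf_int : ∀ θ, ∫ ξ, f θ ξ ∂ν = 1) {g : S → A → Ξ → S} {C : S → A → Ξ → ℝ}
    {γ : ℝ} (hγ : 0 ≤ γ) {V V' : S → Measure Θ → ℝ}
    (hV : Admissible ν f g C γ V) (hV' : Admissible ν f g C γ V') {D : ℝ}
    (hD : ∀ (s : S) (μ : Measure Θ), IsProbabilityMeasure μ → V s μ ≤ V' s μ + D)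
    (s : S) (μ : Measure Θ) [hμ : IsProbabilityMeasure μ] :
    bellman ν f g C γ V s μ ≤ bellman ν f g C γ V' s μ + γ * D := by
  unfold bellman
  rw [← sub_le_iff_le_add]
  refine Finset.le_inf' _ _ fun a ha => ?_
  rw [sub_le_iff_le_add]
  refine (Finset.inf'_le _ ha).trans ?_
  have hf := integrable_density_prod hf_meas hf_nonneg hf_int μ
  have hfD : ∫ p : Θ × Ξ, γ * D * f p.1 p.2 ∂μ.prod ν = γ * D := by
    rw [integral_const_mul, integral_prod _ hf]
    simp [hf_int]
  rw [← integral_prod _ (hV.2 s a μ hμ), ← integral_prod _ (hV'.2 s a μ hμ), ← hfD,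
    ← integral_add (hV'.2 s a μ hμ) (hf.const_mul _)]
  refine integral_mono (hV.2 s a μ hμ) ((hV'.2 s a μ hμ).add (hf.const_mul _)) fun p => ?_
  have hstep := mul_le_mul_of_nonneg_left
    (hD (g s a p.2) _ (isProbabilityMeasure_posterior hf_nonneg μ p.2)) hγ
  have hmul := mul_le_mul_of_nonneg_right hstep (hf_nonneg p.1 p.2)
  beta_reduce
  linarith

/-- Two bounded admissible fixed points of the Bellman operator are ordered. -/
theorem bellman_fixed_point_le {Θ Ξ S A : Type*} [MeasurableSpace Θ] [MeasurableSpace Ξ]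
    [Fintype A] [Nonempty A] {ν : Measure Ξ} [SigmaFinite ν] {f : Θ → Ξ → ℝ}
    (hf_meas : Measurable (Function.uncurry f)) (hf_nonneg : ∀ θ ξ, 0 ≤ f θ ξ)
    (hf_int : ∀ θ, ∫ ξ, f θ ξ ∂ν = 1) {g : S → A → Ξ → S} {C : S → A → Ξ → ℝ}
    {γ : ℝ} (hγ : γ ∈ Set.Ioo (0 : ℝ) 1) {V V' : S → Measure Θ → ℝ}
    (hV : Admissible ν f g C γ V) (hV' : Admissible ν f g C γ V')
    (hfix : ∀ (s : S) (μ : Measure Θ), IsProbabilityMeasure μ →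
      bellman ν f g C γ V s μ = V s μ)
    (hfix' : ∀ (s : S) (μ : Measure Θ), IsProbabilityMeasure μ →
      bellman ν f g C γ V' s μ = V' s μ)
    (s : S) (μ : Measure Θ) [hμ : IsProbabilityMeasure μ] : V s μ ≤ V' s μ := by
  obtain ⟨M, hM⟩ := hV.1
  obtain ⟨M', hM'⟩ := hV'.1
  have hbound : ∀ (n : ℕ) (s : S) (μ : Measure Θ), IsProbabilityMeasure μ →
      V s μ ≤ V' s μ + γ ^ n * (M + M') := by
    intro n
    induction n with
    | zero =>
      intro s μ _
      linarith [(abs_le.1 (hM s μ)).2, (abs_le.1 (hM' s μ)).1]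
    | succ n ih =>
      intro s μ hμ
      have h := bellman_le_bellman_add hf_meas hf_nonneg hf_int hγ.1.le hV hV' ih s μ
      rwa [hfix s μ hμ, hfix' s μ hμ, ← mul_assoc, ← pow_succ'] at h
  have hlim : Filter.Tendsto (fun n : ℕ => V' s μ + γ ^ n * (M + M')) Filter.atTop
      (nhds (V' s μ)) := by
    simpa using ((tendsto_pow_atTop_nhds_zero_of_lt_one hγ.1.le hγ.2).mul_const
      (M + M')).const_add (V' s μ)
  exact ge_of_tendsto' hlim fun n => hbound n s μ hμ

/-- **Uniqueness of the solution of the risk-adjusted Bellman equation**: if two bounded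
admissible functions are both fixed points of the risk-neutral Bellman operator on all
states and probability measures, they coincide there. -/
theorem bellman_fixed_point_unique
    {Θ Ξ S A : Type*} [MeasurableSpace Θ] [MeasurableSpace Ξ] [Fintype A] [Nonempty A]
    (ν : Measure Ξ) [SigmaFinite ν]
    (f : Θ → Ξ → ℝ)
    (hf_meas : Measurable (Function.uncurry f))
    (hf_nonneg : ∀ θ ξ, 0 ≤ f θ ξ)
    (hf_int : ∀ θ, ∫ ξ, f θ ξ ∂ν = 1)
    (g : S → A → Ξ → S)
    (C : S → A → Ξ → ℝ) (Z : ℝ)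
    (hC_bdd : ∀ s a ξ, |C s a ξ| ≤ Z)
    (hC_meas : ∀ s a, Measurable (fun ξ => C s a ξ))
    (γ : ℝ) (hγ : γ ∈ Set.Ioo (0 : ℝ) 1)
    (V V' : S → Measure Θ → ℝ)
    (hV : Admissible ν f g C γ V) (hV' : Admissible ν f g C γ V')
    (hfix : ∀ (s : S) (μ : Measure Θ), IsProbabilityMeasure μ →
      bellman ν f g C γ V s μ = V s μ)
    (hfix' : ∀ (s : S) (μ : Measure Θ), IsProbabilityMeasure μ →
      bellman ν f g C γ V' s μ = V' s μ) :
    ∀ (s : S) (μ : Measure Θ), IsProbabilityMeasure μ → V s μ = V' s μ := by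
  intro s μ _
  exact le_antisymm
    (bellman_fixed_point_le hf_meas hf_nonneg hf_int hγ hV hV' hfix hfix' s μ)
    (bellman_fixed_point_le hf_meas hf_nonneg hf_int hγ hV' hV hfix' hfix s μ)
end

section
/- Let X be a nonempty type, γ ∈ (0,1), and let T be an operator on real-valued functions on X that maps bounded functions to bounded functions and satisfies: (i) monotonicity, i.e. for all bounded V, V' : X → ℝ with V(x) ≤ V'(x) for all x, one has (T V)(x) ≤ (T V')(x) for all x; and (ii) the weight-shift property, i.e. for every bounded V : X → ℝ and every r ∈ ℝ, T(V + r·1) = T V + γ r·1. Then for all bounded V, V' : X → ℝ and every k ∈ ℕ, sup_{x ∈ X} |(T^k V)(x) − (T^k V')(x)| ≤ γ^k · sup_{x ∈ X} |V(x) − V'(x)|; that is, T is a γ-contraction for the supremum norm. -/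
/-- A monotone, weight-shifting operator scales uniform bounds on differences by `γ`. -/
theorem abs_sub_le_mul_of_monotone_of_shift {X : Type*} {γ : ℝ} {T : (X → ℝ) → (X → ℝ)}
    (hmono : ∀ V V' : X → ℝ, (∃ M : ℝ, ∀ x, |V x| ≤ M) → (∃ M : ℝ, ∀ x, |V' x| ≤ M) →
      (∀ x, V x ≤ V' x) → ∀ x, T V x ≤ T V' x)
    (hshift : ∀ V : X → ℝ, (∃ M : ℝ, ∀ x, |V x| ≤ M) → ∀ r : ℝ,
      T (fun x => V x + r) = fun x => T V x + γ * r)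
    {V V' : X → ℝ} (hV : ∃ M : ℝ, ∀ x, |V x| ≤ M) (hV' : ∃ M : ℝ, ∀ x, |V' x| ≤ M)
    {c : ℝ} (hc : ∀ x, |V x - V' x| ≤ c) (x : X) : |T V x - T V' x| ≤ γ * c := by
  have le_add : ∀ U U' : X → ℝ, (∃ M : ℝ, ∀ x, |U x| ≤ M) → (∃ M : ℝ, ∀ x, |U' x| ≤ M) →
      (∀ x, U x ≤ U' x + c) → T U x ≤ T U' x + γ * c := by
    intro U U' hU hU' h
    have hb : ∃ M : ℝ, ∀ x, |U' x + c| ≤ M := by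
      obtain ⟨M, hM⟩ := hU'
      exact ⟨M + |c|, fun y => (abs_add_le _ _).trans (by linarith [hM y])⟩
    simpa only [hshift U' hU' c] using hmono U (fun y => U' y + c) hU hb h x
  have h₁ := le_add V V' hV hV' fun y => by linarith [(abs_le.mp (hc y)).2]
  have h₂ := le_add V' V hV' hV fun y => by linarith [(abs_le.mp (hc y)).1]
  exact abs_le.mpr ⟨by linarith, by linarith⟩

/-- **γ-contraction of a monotone, weight-shifting operator.** If an operator `T` on
real-valued functions on a nonempty type `X` maps bounded functions to bounded functions,
is monotone, and satisfies the weight-shift property `T(V + r·1) = T V + γ r·1`, then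
for all bounded `V, V'` and every `k ∈ ℕ`,
`sup_x |(T^k V)(x) − (T^k V')(x)| ≤ γ^k · sup_x |V(x) − V'(x)|`. -/
theorem iterate_contraction
    {X : Type*} [Nonempty X] (γ : ℝ) (hγ : γ ∈ Set.Ioo (0 : ℝ) 1)
    (T : (X → ℝ) → (X → ℝ))
    (hbdd : ∀ V : X → ℝ, (∃ M : ℝ, ∀ x, |V x| ≤ M) → ∃ M : ℝ, ∀ x, |T V x| ≤ M)
    (hmono : ∀ V V' : X → ℝ, (∃ M : ℝ, ∀ x, |V x| ≤ M) → (∃ M : ℝ, ∀ x, |V' x| ≤ M) →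
      (∀ x, V x ≤ V' x) → ∀ x, T V x ≤ T V' x)
    (hshift : ∀ V : X → ℝ, (∃ M : ℝ, ∀ x, |V x| ≤ M) → ∀ r : ℝ,
      T (fun x => V x + r) = fun x => T V x + γ * r) :
    ∀ V V' : X → ℝ, (∃ M : ℝ, ∀ x, |V x| ≤ M) → (∃ M : ℝ, ∀ x, |V' x| ≤ M) → ∀ k : ℕ,
      (⨆ x, |T^[k] V x - T^[k] V' x|) ≤ γ ^ k * ⨆ x, |V x - V' x| := by
  intro V V' hV hV' k
  have hbound : ∀ x, |V x - V' x| ≤ ⨆ y, |V y - V' y| := by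
    obtain ⟨M, hM⟩ := hV
    obtain ⟨M', hM'⟩ := hV'
    refine le_ciSup (f := fun y => |V y - V' y|) ⟨M + M', ?_⟩
    rintro _ ⟨y, rfl⟩
    exact (abs_sub _ _).trans (add_le_add (hM y) (hM' y))
  have hiter : ∀ U : X → ℝ, (∃ M : ℝ, ∀ x, |U x| ≤ M) → ∀ n : ℕ,
      ∃ M : ℝ, ∀ x, |T^[n] U x| ≤ M := by
    intro U hU n
    induction n with
    | zero => exact hU
    | succ n ih =>
      rw [Function.iterate_succ_apply']
      exact hbdd _ ih
  refine ciSup_le ?_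
  induction k with
  | zero => simpa using hbound
  | succ n ih =>
    intro x
    rw [Function.iterate_succ_apply', Function.iterate_succ_apply', pow_succ', mul_assoc]
    exact abs_sub_le_mul_of_monotone_of_shift hmono hshift (hiter V hV n) (hiter V' hV' n) ih x
end
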